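/- Let B be a stationary Bratteli diagram with N × N incidence matrix F whose tail equivalence relation R is aperiodic, and let A = F^T. Suppose λ > 0 and x = (x_1,…,x_N) is a nonnegative eigenvector with Ax = λx, normalized so that Σ_{w ∈ V_1} h_w^{(1)} x_w = 1. Then there exists an R-invariant Borel probability measure μ on X_B such that μ(X_i^{(n)}(ē)) = x_i / λ^{n−1} for every n ≥ 1, every vertex i ∈ V_n, and every finite path ē from v_0 to i. -/

import Mathlib

open MeasureTheory

/-- A Bratteli diagram. -/
structure BratteliDiagram where
  V : ℕ → Type
  E : ℕ → Type
  fintypeV : ∀ n, Fintype (V n)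
  fintypeE : ∀ n, Fintype (E n)
  nonemptyV : ∀ n, Nonempty (V n)
  nonemptyE : ∀ n, Nonempty (E n)
  root_subsingleton : ∀ v w : V 0, v = w
  src : ∀ n, E n → V n
  rng : ∀ n, E n → V (n + 1)
  src_surj : ∀ n, Function.Surjective (src n)
  rng_surj : ∀ n, Function.Surjective (rng n)

attribute [instance] BratteliDiagram.fintypeV BratteliDiagram.fintypeE
  BratteliDiagram.nonemptyV BratteliDiagram.nonemptyE

namespace BratteliDiagram

variable (B : BratteliDiagram)

instance (n : ℕ) : TopologicalSpace (B.E n) := ⊥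

/-- The path space `X_B` of a Bratteli diagram. -/
def PathSpace : Type :=
  { x : ∀ n, B.E n // ∀ n, B.rng n (x n) = B.src (n + 1) (x (n + 1)) }

instance : TopologicalSpace B.PathSpace := by unfold PathSpace; infer_instance

noncomputable instance : MeasurableSpace B.PathSpace := borel _

/-- The vertex at level `n` through which a path passes. -/
def endVtx (n : ℕ) (x : B.PathSpace) : B.V n := B.src n (x.1 n)

/-- The cylinder set of paths agreeing with `x` on the first `n` edges. -/
def cyl (n : ℕ) (x : B.PathSpace) : Set B.PathSpace := { y | ∀ i < n, y.1 i = x.1 i }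

/-- Tail equivalence of paths. -/
def tailEq (x y : B.PathSpace) : Prop := ∃ N, ∀ n, N ≤ n → x.1 n = y.1 n

/-- The tail equivalence relation is aperiodic: all classes are infinite. -/
def TailAperiodic : Prop := ∀ x : B.PathSpace, { y | B.tailEq x y }.Infinite

/-- A measure is invariant for the tail equivalence relation if any two
cylinder sets ending at the same vertex have equal measure. -/
def TailInvariant (μ : Measure B.PathSpace) : Prop :=
  ∀ (n : ℕ) (x y : B.PathSpace), B.endVtx n x = B.endVtx n y →
    μ (B.cyl n x) = μ (B.cyl n y)

/-- Ergodicity with respect to the tail equivalence relation. -/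
def TailErgodic (μ : Measure B.PathSpace) : Prop :=
  ∀ S : Set B.PathSpace, MeasurableSet S →
    (∀ x y, B.tailEq x y → (x ∈ S ↔ y ∈ S)) → μ S = 0 ∨ μ Sᶜ = 0

/-- The type of finite paths from the root vertex to `v`. -/
def FinPathTo : ∀ n, B.V n → Type
  | 0, _ => PUnit
  | n + 1, v => Σ e : { e : B.E n // B.rng n e = v }, FinPathTo n (B.src n e.1)

/-- The height `h_v^{(n)}`: the number of finite paths from the root to `v`. -/
noncomputable def height (n : ℕ) (v : B.V n) : ℕ := Nat.card (B.FinPathTo n v)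

/-- The number of edges from `w ∈ V_n` to `v ∈ V_{n+1}`; the entry `f^{(n)}_{v,w}`
of the incidence matrix `F_n`. -/
noncomputable def edgeCount (n : ℕ) (v : B.V (n + 1)) (w : B.V n) : ℕ :=
  Nat.card { e : B.E n // B.rng n e = v ∧ B.src n e = w }

/-- The incidence matrix `F_n`, as a real matrix. -/
noncomputable def incMat (n : ℕ) : Matrix (B.V (n + 1)) (B.V n) ℝ :=
  fun v w => (B.edgeCount n v w : ℝ)

end BratteliDiagram

namespace BratteliDiagram

variable (B : BratteliDiagram)

instance (n : ℕ) : DiscreteTopology (B.E n) := ⟨rfl⟩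

instance : TopologicalSpace.MetrizableSpace B.PathSpace :=
  have : TopologicalSpace.MetrizableSpace (∀ n, B.E n) :=
    TopologicalSpace.metrizableSpace_of_t3_secondCountable _
  Topology.IsEmbedding.subtypeVal.metrizableSpace

instance : BorelSpace B.PathSpace := ⟨rfl⟩

theorem continuous_edge (n : ℕ) : Continuous fun x : B.PathSpace => x.1 n :=
  (continuous_apply n).comp continuous_subtype_val

instance : CompactSpace B.PathSpace := by
  refine isCompact_iff_compactSpace.mp (?_ : IsCompact { x : ∀ n, B.E n |
    ∀ n, B.rng n (x n) = B.src (n + 1) (x (n + 1)) })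
  refine IsClosed.isCompact ?_
  rw [Set.ofPred_forall]
  refine isClosed_iInter fun n => ?_
  exact (isClosed_discrete { p : B.E n × B.E (n + 1) | B.rng n p.1 = B.src (n + 1) p.2 }).preimage
    ((continuous_apply n).prodMk (continuous_apply (n + 1)))

theorem isClopen_cyl (n : ℕ) (x : B.PathSpace) : IsClopen (B.cyl n x) := by
  have h : B.cyl n x = ⋂ i ∈ Set.Iio n, (fun y : B.PathSpace => y.1 i) ⁻¹' {x.1 i} := by
    ext y
    simp [cyl]
  rw [h]
  exact (Set.finite_Iio n).isClopen_biInter fun i _ =>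
    (isClopen_discrete _).preimage (B.continuous_edge i)

theorem cyl_zero (x : B.PathSpace) : B.cyl 0 x = Set.univ := by
  simp [cyl]

theorem mem_cyl_succ {n : ℕ} {x y : B.PathSpace} :
    y ∈ B.cyl (n + 1) x ↔ y ∈ B.cyl n x ∧ y.1 n = x.1 n := by
  simp only [cyl, Set.mem_ofPred_eq, Nat.lt_succ_iff_lt_or_eq]
  exact ⟨fun h => ⟨fun i hi => h i (Or.inl hi), h n (Or.inr rfl)⟩,
    fun h i hi => hi.elim (h.1 i) fun e => e ▸ h.2⟩

theorem endVtx_eq_of_mem_cyl {n : ℕ} {x y : B.PathSpace} (h : y ∈ B.cyl n x) :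
    B.endVtx n y = B.endVtx n x := by
  cases n with
  | zero => exact B.root_subsingleton _ _
  | succ n =>
    rw [endVtx, endVtx, ← y.2 n, ← x.2 n, (B.mem_cyl_succ.1 h).2]

/-- A sequence of edges that is composable up to level `m` extends to an infinite path. -/
theorem exists_path_extending (m : ℕ) (u : ∀ n, B.E n)
    (hu : ∀ n < m, B.rng n (u n) = B.src (n + 1) (u (n + 1))) :
    ∃ z : B.PathSpace, ∀ n ≤ m, z.1 n = u n := by
  classical
  let z : ∀ n, B.E n := fun n => Nat.rec (u 0)
    (fun n e => if n + 1 ≤ m then u (n + 1) else (B.src_surj (n + 1) (B.rng n e)).choose) n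
  have hz : ∀ n, z (n + 1) =
      if n + 1 ≤ m then u (n + 1) else (B.src_surj (n + 1) (B.rng n (z n))).choose := fun _ => rfl
  have hzu : ∀ n ≤ m, z n = u n := by
    intro n hn
    cases n with
    | zero => rfl
    | succ n => rw [hz, if_pos hn]
  refine ⟨⟨z, fun n => ?_⟩, hzu⟩
  by_cases h : n + 1 ≤ m
  · rw [hzu n (by omega), hzu (n + 1) h, hu n h]
  · rw [hz, if_neg h, (B.src_surj (n + 1) (B.rng n (z n))).choose_spec]

instance : Nonempty B.PathSpace :=
  let ⟨z, _⟩ := B.exists_path_extending 0 (fun _ => Classical.arbitrary _) (by simp)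
  ⟨z⟩

theorem exists_graft (m : ℕ) (y : B.PathSpace) (e : B.E m) (he : B.src m e = B.endVtx m y) :
    ∃ z : B.PathSpace, z ∈ B.cyl m y ∧ z.1 m = e := by
  classical
  obtain ⟨z, hz⟩ := B.exists_path_extending m (Function.update y.1 m e) (by
    intro n hn
    rw [Function.update_of_ne hn.ne]
    rcases Nat.lt_or_eq_of_le (Nat.succ_le_of_lt hn) with h | h
    · rw [Function.update_of_ne h.ne, y.2 n]
    · subst h
      rw [Function.update_self, he, y.2 n, endVtx])
  refine ⟨z, fun i hi => ?_, ?_⟩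
  · rw [hz i hi.le, Function.update_of_ne hi.ne]
  · rw [hz m le_rfl, Function.update_self]

open Classical in
/-- A path that follows `y` up to level `m` and then takes the edge `e`, whenever
`e` starts at the vertex of `y` at level `m`. -/
noncomputable def graft (m : ℕ) (y : B.PathSpace) (e : B.E m) : B.PathSpace :=
  if he : B.src m e = B.endVtx m y then (B.exists_graft m y e he).choose else y

section graft

variable {B} {m : ℕ} {y : B.PathSpace} {e : B.E m}

theorem graft_mem_cyl (he : B.src m e = B.endVtx m y) : B.graft m y e ∈ B.cyl m y := by
  rw [graft, dif_pos he]
  exact (B.exists_graft m y e he).choose_spec.1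

theorem graft_apply_self (he : B.src m e = B.endVtx m y) : (B.graft m y e).1 m = e := by
  rw [graft, dif_pos he]
  exact (B.exists_graft m y e he).choose_spec.2

theorem endVtx_succ_graft (he : B.src m e = B.endVtx m y) :
    B.endVtx (m + 1) (B.graft m y e) = B.rng m e := by
  rw [endVtx, ← (B.graft m y e).2 m, graft_apply_self he]

theorem graft_mem_cyl_iff (he : B.src m e = B.endVtx m y) {n : ℕ} (hn : n ≤ m)
    (x : B.PathSpace) : B.graft m y e ∈ B.cyl n x ↔ y ∈ B.cyl n x := by
  have h := graft_mem_cyl he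
  exact forall₂_congr fun i hi => by rw [h i (hi.trans_le hn)]

end graft

open Classical in
/-- One infinite path for each finite path of length `m` from the root. -/
noncomputable def reps : ℕ → Multiset B.PathSpace
  | 0 => {Classical.arbitrary _}
  | m + 1 => (reps m).bind fun y =>
      (Finset.univ.filter fun e : B.E m => B.src m e = B.endVtx m y).val.map (B.graft m y)

open Classical in
theorem sum_reps_succ {M : Type*} [AddCommMonoid M] (m : ℕ) (f : B.PathSpace → M) :
    ((B.reps (m + 1)).map f).sum = ((B.reps m).map fun y =>
      ∑ e : B.E m with B.src m e = B.endVtx m y, f (B.graft m y e)).sum := by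
  simp only [reps, Multiset.map_bind, Multiset.sum_bind, Multiset.map_map]
  rfl

open Classical in
theorem card_reps_mem_cyl (m : ℕ) (x : B.PathSpace) :
    ((B.reps m).map fun y => if y ∈ B.cyl m x then (1 : ENNReal) else 0).sum = 1 := by
  induction m with
  | zero => simp [reps, cyl_zero]
  | succ m ih =>
    rw [sum_reps_succ]
    refine Eq.trans ?_ ih
    congr 1
    refine Multiset.map_congr rfl fun y _ => ?_
    have h : ∀ e ∈ Finset.univ.filter (fun e : B.E m => B.src m e = B.endVtx m y),
        (if B.graft m y e ∈ B.cyl (m + 1) x then (1 : ENNReal) else 0) =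
          if e = x.1 m then (if y ∈ B.cyl m x then 1 else 0) else 0 := by
      intro e he
      have he := (Finset.mem_filter.1 he).2
      rw [mem_cyl_succ, graft_mem_cyl_iff he le_rfl, graft_apply_self he]
      split_ifs <;> simp_all
    rw [Finset.sum_congr rfl h, Finset.sum_ite_eq']
    by_cases hy : y ∈ B.cyl m x
    · have hv : B.src m (x.1 m) = B.endVtx m y := (B.endVtx_eq_of_mem_cyl hy).symm
      simp [hy, hv]
    · simp [hy]

/-- The finite sum of point masses that gives the representative `y` of a finite path of
length `m` the weight `w (B.endVtx m y)`. -/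
noncomputable def atomicMeasure (m : ℕ) (w : B.V m → ENNReal) : Measure B.PathSpace :=
  ((B.reps m).map fun y => w (B.endVtx m y) • Measure.dirac y).sum

open Classical in
theorem atomicMeasure_apply (m : ℕ) (w : B.V m → ENNReal) {S : Set B.PathSpace}
    (hS : MeasurableSet S) : B.atomicMeasure m w S =
      ((B.reps m).map fun y => if y ∈ S then w (B.endVtx m y) else 0).sum := by
  rw [atomicMeasure]
  induction B.reps m using Multiset.induction with
  | empty => simp
  | cons y s ih =>
    simp [ih, Measure.dirac_apply' _ hS, Set.indicator_apply]

theorem measurableSet_cyl (n : ℕ) (x : B.PathSpace) : MeasurableSet (B.cyl n x) :=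
  (B.isClopen_cyl n x).isOpen.measurableSet

theorem atomicMeasure_cyl_self (m : ℕ) (w : B.V m → ENNReal) (x : B.PathSpace) :
    B.atomicMeasure m w (B.cyl m x) = w (B.endVtx m x) := by
  classical
  rw [B.atomicMeasure_apply m w (B.measurableSet_cyl m x)]
  trans ((B.reps m).map fun y =>
    w (B.endVtx m x) * if y ∈ B.cyl m x then (1 : ENNReal) else 0).sum
  · congr 1
    refine Multiset.map_congr rfl fun y _ => ?_
    split_ifs with hy
    · rw [B.endVtx_eq_of_mem_cyl hy, mul_one]
    · rw [mul_zero]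
  · rw [Multiset.sum_map_mul_left, card_reps_mem_cyl, mul_one]

open Classical in
theorem atomicMeasure_succ_cyl {m : ℕ} {w : B.V m → ENNReal} {w' : B.V (m + 1) → ENNReal}
    (hw : ∀ v, ∑ e : B.E m with B.src m e = v, w' (B.rng m e) = w v)
    {n : ℕ} (hn : n ≤ m) (x : B.PathSpace) :
    B.atomicMeasure (m + 1) w' (B.cyl n x) = B.atomicMeasure m w (B.cyl n x) := by
  rw [B.atomicMeasure_apply _ _ (B.measurableSet_cyl n x),
    B.atomicMeasure_apply _ _ (B.measurableSet_cyl n x), sum_reps_succ]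
  congr 1
  refine Multiset.map_congr rfl fun y _ => ?_
  have h : ∀ e ∈ Finset.univ.filter (fun e : B.E m => B.src m e = B.endVtx m y),
      (if B.graft m y e ∈ B.cyl n x then w' (B.endVtx (m + 1) (B.graft m y e)) else 0) =
        if y ∈ B.cyl n x then w' (B.rng m e) else 0 := by
    intro e he
    have he := (Finset.mem_filter.1 he).2
    simp only [graft_mem_cyl_iff he hn, endVtx_succ_graft he]
  rw [Finset.sum_congr rfl h]
  split_ifs with hy
  · exact hw _
  · simp

open Classical in
/-- Compatible weights on the vertices, of total mass one, come from a probability measure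
on the path space. -/
theorem exists_measure_of_weights (w : ∀ m, B.V m → ENNReal)
    (hw : ∀ m v, ∑ e : B.E m with B.src m e = v, w (m + 1) (B.rng m e) = w m v)
    (hw0 : ∀ v, w 0 v = 1) :
    ∃ μ : Measure B.PathSpace, IsProbabilityMeasure μ ∧
      ∀ n x, μ (B.cyl n x) = w n (B.endVtx n x) := by
  have hcyl : ∀ n x m, n ≤ m → B.atomicMeasure m (w m) (B.cyl n x) = w n (B.endVtx n x) := by
    intro n x m hm
    induction m, hm using Nat.le_induction with
    | base => exact B.atomicMeasure_cyl_self n (w n) x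
    | succ m hm ih => rw [B.atomicMeasure_succ_cyl (hw m) hm, ih]
  let ν : ℕ → ProbabilityMeasure B.PathSpace := fun m => ⟨B.atomicMeasure m (w m), ⟨by
    rw [← B.cyl_zero (Classical.arbitrary _), hcyl 0 _ m m.zero_le, hw0]⟩⟩
  obtain ⟨μ, hμ⟩ := exists_clusterPt_of_compactSpace (Filter.map ν Filter.atTop)
  obtain ⟨f, hf, hfμ⟩ := mapClusterPt_iff_ultrafilter.1 hμ
  refine ⟨μ, inferInstance, fun n x => ?_⟩
  have hlim := ProbabilityMeasure.tendsto_measure_of_null_frontier_of_tendsto' hfμ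
    (E := B.cyl n x) (by rw [(B.isClopen_cyl n x).frontier_eq, measure_empty])
  refine tendsto_nhds_unique hlim (tendsto_const_nhds.congr' ?_)
  filter_upwards [hf (Filter.eventually_ge_atTop n)] with m hm
  exact (hcyl n x m hm).symm

open Classical in
theorem sum_edges_from (n : ℕ) (v : B.V n) (g : B.V (n + 1) → ℝ) :
    ∑ e : B.E n with B.src n e = v, g (B.rng n e) =
      ∑ u : B.V (n + 1), (B.edgeCount n u v : ℝ) * g u := by
  rw [← Finset.sum_fiberwise_of_maps_to (g := B.rng n) (t := Finset.univ) (by simp)]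
  refine Finset.sum_congr rfl fun u _ => ?_
  rw [Finset.sum_congr rfl fun e he => by rw [(Finset.mem_filter.1 he).2], Finset.sum_const,
    nsmul_eq_mul, edgeCount, Nat.card_eq_fintype_card, Fintype.card_subtype, Finset.filter_filter]
  simp only [and_comm]

theorem height_one (u : B.V 1) (v : B.V 0) : B.height 1 u = B.edgeCount 0 u v := by
  refine Nat.card_congr ((Equiv.sigmaPUnit _).trans (Equiv.subtypeEquivRight fun e => ?_))
  exact ⟨fun h => ⟨h, B.root_subsingleton _ _⟩, And.left⟩

end BratteliDiagram

/-- **Bezuglyi–Kwiatkowski–Medynets–Solomyak.** On a stationary Bratteli diagram with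
aperiodic tail equivalence relation, a normalized nonnegative eigenvector `x` of
`A = F^T` with eigenvalue `λ > 0` defines a tail-invariant probability measure with
`μ(X_i^{(n)}(ē)) = x_i / λ^{n−1}`. -/
theorem stationary_eigenvector_gives_invariant_measure
    (B : BratteliDiagram)
    (hCantor : ∀ x : B.PathSpace, ¬IsOpen ({x} : Set B.PathSpace))
    (haper : B.TailAperiodic)
    (N : ℕ) (hN : 0 < N)
    (ident : ∀ n : ℕ, B.V (n + 1) ≃ Fin N)
    (F : Matrix (Fin N) (Fin N) ℝ)
    (hstat : ∀ (n : ℕ) (v : B.V (n + 2)) (w : B.V (n + 1)),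
      F (ident (n + 1) v) (ident n w) = (B.edgeCount (n + 1) v w : ℝ))
    (lam : ℝ) (hlam : 0 < lam)
    (xv : Fin N → ℝ) (hxv : ∀ i, 0 ≤ xv i)
    (heig : F.transpose.mulVec xv = lam • xv)
    (hnorm : ∑ w : B.V 1, (B.height 1 w : ℝ) * xv (ident 0 w) = 1) :
    ∃ μ : Measure B.PathSpace, IsProbabilityMeasure μ ∧ B.TailInvariant μ ∧
      ∀ (n : ℕ) (x : B.PathSpace),
        (μ (B.cyl (n + 1) x)).toReal = xv (ident n (B.endVtx (n + 1) x)) / lam ^ n := by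
  classical
  let w : ∀ m, B.V m → ENNReal
    | 0 => fun _ => 1
    | n + 1 => fun v => ENNReal.ofReal (xv (ident n v) / lam ^ n)
  obtain ⟨μ, hμ, hcyl⟩ := B.exists_measure_of_weights w (by
    intro m v
    cases m with
    | zero =>
      change ∑ e : B.E 0 with _, ENNReal.ofReal (xv (ident 0 (B.rng 0 e)) / lam ^ 0) = 1
      rw [← ENNReal.ofReal_sum_of_nonneg fun e _ => div_nonneg (hxv _) (by positivity),
        B.sum_edges_from 0 v fun u => xv (ident 0 u) / lam ^ 0]
      simp only [← B.height_one _ v, pow_zero, div_one, hnorm, ENNReal.ofReal_one]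
    | succ n =>
      change ∑ e : B.E (n + 1) with _,
        ENNReal.ofReal (xv (ident (n + 1) (B.rng (n + 1) e)) / lam ^ (n + 1)) =
          ENNReal.ofReal (xv (ident n v) / lam ^ n)
      rw [← ENNReal.ofReal_sum_of_nonneg fun e _ => div_nonneg (hxv _) (by positivity),
        B.sum_edges_from (n + 1) v fun u => xv (ident (n + 1) u) / lam ^ (n + 1)]
      have h := congrFun heig (ident n v)
      simp only [Matrix.mulVec, dotProduct, Matrix.transpose_apply, Pi.smul_apply,
        smul_eq_mul] at h
      rw [← (ident (n + 1)).sum_comp] at h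
      simp only [← hstat, ← mul_div_assoc, ← Finset.sum_div, h]
      congr 1
      field_simp
      ring) fun _ => rfl
  refine ⟨μ, hμ, fun n x y hxy => by rw [hcyl, hcyl, hxy], fun n x => ?_⟩
  rw [hcyl]
  exact ENNReal.toReal_ofReal (div_nonneg (hxv _) (by positivity))
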